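/- Let n ∈ ℕ, n ≥ 1, and c ∈ ℝ³, and define the Raviart–Thomas space ℛ𝒯ⁿ_c := 𝒞^{n−1} + 𝒞ⁿ_c, where 𝒞^{n−1} := {curl v : v ∈ (𝒫ⁿ)³} and 𝒞ⁿ_c := {x ↦ p(x)(x − c) : p ∈ 𝒫^{n−1}}. Then: (i) the sum 𝒞^{n−1} + 𝒞ⁿ_c is direct; (ii) ℛ𝒯ⁿ_c = (𝒫^{n−1})³ + {x ↦ p(x)(x − c) : p ∈ 𝒫^{n−1}}; (iii) the inclusions (𝒫^{n−1})³ ⊂ ℛ𝒯ⁿ_c ⊂ (𝒫ⁿ)³ hold and are both strict. -/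

import Mathlib

open Matrix MeasureTheory
open scoped InnerProductSpace

noncomputable section

/-- Scalar polynomial functions `ℝ^d → ℝ` of total degree at most `n`. -/
def polySpace (d n : ℕ) : Submodule ℝ ((Fin d → ℝ) → ℝ) where
  carrier := {f | ∃ p : MvPolynomial (Fin d) ℝ,
    p.totalDegree ≤ n ∧ ∀ x, f x = MvPolynomial.eval x p}
  add_mem' := by
    rintro f g ⟨p, hp, hfp⟩ ⟨q, hq, hgq⟩
    exact ⟨p + q, le_trans (MvPolynomial.totalDegree_add p q) (max_le hp hq),
      fun x => by simp [hfp x, hgq x]⟩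
  zero_mem' := ⟨0, by simp, fun x => by simp⟩
  smul_mem' := by
    rintro a f ⟨p, hp, hfp⟩
    exact ⟨a • p, le_trans (MvPolynomial.totalDegree_smul_le a p) hp,
      fun x => by simp [hfp x, MvPolynomial.smul_eval]⟩

/-- Scalar polynomial functions of total degree at most `n` for `n : ℤ`,
with the convention that the space is `{0}` for negative `n`. -/
def polySpaceZ (d : ℕ) (n : ℤ) : Submodule ℝ ((Fin d → ℝ) → ℝ) :=
  if 0 ≤ n then polySpace d n.toNat else ⊥

/-- Vector-valued polynomial maps `ℝ^d → ℝ^d`, all of whose components are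
polynomial functions of total degree at most `n` (`n : ℤ`). -/
def vecPolySpaceZ (d : ℕ) (n : ℤ) : Submodule ℝ ((Fin d → ℝ) → (Fin d → ℝ)) where
  carrier := {f | ∀ i, (fun x => f x i) ∈ polySpaceZ d n}
  add_mem' := fun hf hg i => (polySpaceZ d n).add_mem (hf i) (hg i)
  zero_mem' := fun i => (polySpaceZ d n).zero_mem
  smul_mem' := fun a {f} hf i => (polySpaceZ d n).smul_mem a (hf i)

/-- The gradient `∇v = (∂₁v, …, ∂_d v)` of a scalar field. -/
def grad {d : ℕ} (v : (Fin d → ℝ) → ℝ) : (Fin d → ℝ) → (Fin d → ℝ) :=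
  fun x i => fderiv ℝ v x (Pi.single i 1)

/-- The divergence `div τ = Σᵢ ∂ᵢ τᵢ` of a vector field. -/
def divg {d : ℕ} (τ : (Fin d → ℝ) → (Fin d → ℝ)) : (Fin d → ℝ) → ℝ :=
  fun x => ∑ i, fderiv ℝ (fun y => τ y i) x (Pi.single i 1)

/-- The curl of a vector field on `ℝ³`. -/
def curl (v : (Fin 3 → ℝ) → (Fin 3 → ℝ)) : (Fin 3 → ℝ) → (Fin 3 → ℝ) :=
  fun x => ![fderiv ℝ (fun y => v y 2) x (Pi.single 1 1) - fderiv ℝ (fun y => v y 1) x (Pi.single 2 1),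
             fderiv ℝ (fun y => v y 0) x (Pi.single 2 1) - fderiv ℝ (fun y => v y 2) x (Pi.single 0 1),
             fderiv ℝ (fun y => v y 1) x (Pi.single 0 1) - fderiv ℝ (fun y => v y 0) x (Pi.single 1 1)]

/-- Rotation of a vector in `ℝ²` by `-π/2`: `(z₁, z₂)^⊥ = (z₂, -z₁)`. -/
def perp (z : Fin 2 → ℝ) : Fin 2 → ℝ := ![z 1, -z 0]

open MvPolynomial in
theorem aux_deg_pderiv (i : Fin 3) (p : MvPolynomial (Fin 3) ℝ) :
    (pderiv i p).totalDegree ≤ p.totalDegree - 1 := by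
  rw [totalDegree, Finset.sup_le_iff]
  intro s hs
  rw [mem_support_iff, coeff_pderiv] at hs
  have h2 := le_totalDegree (mem_support_iff.2 (left_ne_zero_of_mul hs))
  rw [Finsupp.sum_add_index' (by simp) (by simp), Finsupp.sum_single_index rfl] at h2
  omega

open MvPolynomial in
theorem aux_hasFDeriv (p : MvPolynomial (Fin 3) ℝ) (x : Fin 3 → ℝ) :
    HasFDerivAt (fun y => eval y p)
      (∑ i, eval x (pderiv i p) • (ContinuousLinearMap.proj i : (Fin 3 → ℝ) →L[ℝ] ℝ)) x := by
  induction p using MvPolynomial.induction_on with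
  | C a => simpa using hasFDerivAt_const a x
  | add p q hp hq =>
    have h := hp.add hq
    simp only [map_add, add_smul, Finset.sum_add_distrib]
    exact h
  | mul_X p j hp =>
    have h := hp.mul (hasFDerivAt_apply (𝕜 := ℝ) j x)
    simp only [map_mul, eval_X]
    refine h.congr_fderiv ?_
    ext y
    fin_cases j <;> simp [pderiv_mul, pderiv_X, Fin.sum_univ_three, Pi.single_apply] <;> ring

open MvPolynomial in
theorem aux_fderiv (p : MvPolynomial (Fin 3) ℝ) (x : Fin 3 → ℝ) (i : Fin 3) :
    fderiv ℝ (fun y => eval y p) x (Pi.single i 1) = eval x (pderiv i p) := by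
  rw [(aux_hasFDeriv p x).fderiv]
  fin_cases i <;> simp [Fin.sum_univ_three]

open MvPolynomial in
theorem aux_comm (i j : Fin 3) (p : MvPolynomial (Fin 3) ℝ) :
    pderiv i (pderiv j p) = pderiv j (pderiv i p) := by
  have : ⁅(pderiv i : Derivation ℝ (MvPolynomial (Fin 3) ℝ) (MvPolynomial (Fin 3) ℝ)),
      (pderiv j : Derivation ℝ (MvPolynomial (Fin 3) ℝ) (MvPolynomial (Fin 3) ℝ))⁆ = 0 := by
    apply MvPolynomial.derivation_ext
    intro k
    simp only [Derivation.commutator_apply, pderiv_X]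
    simp [Pi.single_apply]
    split_ifs <;> simp
  have h := congrArg (fun D => D p) this
  simp only [Derivation.commutator_apply] at h
  simpa [sub_eq_zero] using h

open MvPolynomial in
def aux_E (c : Fin 3 → ℝ) (p : MvPolynomial (Fin 3) ℝ) : MvPolynomial (Fin 3) ℝ :=
  ∑ i, (X i - C (c i)) * pderiv i p

open MvPolynomial in
theorem aux_deg_lin (c : Fin 3 → ℝ) (i : Fin 3) :
    (X i - C (c i) : MvPolynomial (Fin 3) ℝ).totalDegree ≤ 1 :=
  (totalDegree_sub_C_le _ _).trans (by simp)

open MvPolynomial in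
theorem aux_deg_mul_pderiv (k : ℕ) (q p : MvPolynomial (Fin 3) ℝ) (i : Fin 3)
    (hq : q.totalDegree ≤ 1) (hp : p.totalDegree ≤ k) :
    (q * pderiv i p).totalDegree ≤ k := by
  by_cases h : p.totalDegree = 0
  · rw [totalDegree_eq_zero_iff_eq_C] at h
    rw [h]; simp
  · have := totalDegree_mul q (pderiv i p)
    have := aux_deg_pderiv i p
    omega

open MvPolynomial in
theorem aux_deg_E (c : Fin 3 → ℝ) (k : ℕ) (p : MvPolynomial (Fin 3) ℝ)
    (hp : p.totalDegree ≤ k) : (aux_E c p).totalDegree ≤ k :=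
  totalDegree_finsetSum_le fun i _ => aux_deg_mul_pderiv k _ p i (aux_deg_lin c i) hp

open MvPolynomial in
theorem aux_drop (c : Fin 3 → ℝ) (k : ℕ) (p : MvPolynomial (Fin 3) ℝ)
    (hp : p.totalDegree ≤ k + 1) :
    (((k : ℝ) + 1) • p - aux_E c p).totalDegree ≤ k := by
  set h := homogeneousComponent (k+1) p with hh
  have hhom : h.IsHomogeneous (k+1) := homogeneousComponent_isHomogeneous _ _
  have hr : (p - h).totalDegree ≤ k := by
    rw [totalDegree, Finset.sup_le_iff]
    intro s hs
    rw [mem_support_iff, coeff_sub, hh, coeff_homogeneousComponent] at hs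
    have h1 : s.degree ≠ k + 1 := by
      intro h; simp [h] at hs
    rw [if_neg h1, sub_zero] at hs
    have h2 := le_totalDegree (mem_support_iff.2 hs)
    have h3 : s.degree = s.sum fun _ e => e := rfl
    omega
  have he := hhom.sum_X_mul_pderiv
  have key : ((k : ℝ) + 1) • p - aux_E c p =
      ((k : ℝ) + 1) • (p - h) - aux_E c (p - h) + ∑ i, C (c i) * pderiv i h := by
    have : aux_E c p = aux_E c (p - h) + (((k : ℝ) + 1) • h - ∑ i, C (c i) * pderiv i h) := by
      have e : ((k : ℝ) + 1) • h = (k + 1) • h := by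
        rw [← Nat.cast_smul_eq_nsmul ℝ]; simp
      rw [e, ← he]
      simp only [aux_E, Fin.sum_univ_three, map_sub]
      ring
    rw [this, smul_sub]; abel
  rw [key]
  refine (totalDegree_add _ _).trans (max_le ((totalDegree_sub _ _).trans (max_le
    ((totalDegree_smul_le _ _).trans hr) (aux_deg_E c k _ hr))) ?_)
  refine totalDegree_finsetSum_le fun i _ => ?_
  have h1 := totalDegree_mul (C (c i)) (pderiv i h)
  have h2 := aux_deg_pderiv i h
  have h3 := hhom.totalDegree_le
  simp at h1
  omega

open MvPolynomial in
theorem aux_E_zero (c : Fin 3 → ℝ) (p : MvPolynomial (Fin 3) ℝ)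
    (hp : p.totalDegree ≤ 0) : aux_E c p = 0 := by
  have h : p.totalDegree = 0 := by omega
  rw [totalDegree_eq_zero_iff_eq_C] at h
  rw [h]; simp [aux_E]

open MvPolynomial in
theorem aux_inj (c : Fin 3 → ℝ) (k : ℕ) (p : MvPolynomial (Fin 3) ℝ)
    (hp : p.totalDegree ≤ k) (h : (3 : ℝ) • p + aux_E c p = 0) : p = 0 := by
  induction k with
  | zero => rw [aux_E_zero c p hp] at h; simpa using h
  | succ k ih =>
    apply ih
    have h1 := aux_drop c k p hp
    have h2 : ((k : ℝ) + 1) • p - aux_E c p = ((k : ℝ) + 4) • p := by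
      rw [eq_neg_of_add_eq_zero_right h]; module
    rw [h2] at h1
    have h3 : p = ((k : ℝ) + 4)⁻¹ • (((k : ℝ) + 4) • p) := by
      rw [smul_smul, inv_mul_cancel₀ (by positivity), one_smul]
    rw [h3]
    exact (totalDegree_smul_le _ _).trans h1

open MvPolynomial in
def aux_curl (v : Fin 3 → MvPolynomial (Fin 3) ℝ) : Fin 3 → MvPolynomial (Fin 3) ℝ :=
  ![pderiv 1 (v 2) - pderiv 2 (v 1), pderiv 2 (v 0) - pderiv 0 (v 2),
    pderiv 0 (v 1) - pderiv 1 (v 0)]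

open MvPolynomial in
theorem aux_step (c : Fin 3 → ℝ) (k : ℕ) (g : Fin 3 → MvPolynomial (Fin 3) ℝ)
    (hg : ∀ i, (g i).totalDegree ≤ k) :
    ∃ (v : Fin 3 → MvPolynomial (Fin 3) ℝ) (p : MvPolynomial (Fin 3) ℝ),
      (∀ i, (v i).totalDegree ≤ k + 1) ∧ p.totalDegree ≤ k ∧
      ∀ i, (2 : ℝ) • g i + aux_E c (g i) = aux_curl v i + p * (X i - C (c i)) := by
  let w : Fin 3 → MvPolynomial (Fin 3) ℝ :=
    ![g 1 * (X 2 - C (c 2)) - g 2 * (X 1 - C (c 1)),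
      g 2 * (X 0 - C (c 0)) - g 0 * (X 2 - C (c 2)),
      g 0 * (X 1 - C (c 1)) - g 1 * (X 0 - C (c 0))]
  let dv : MvPolynomial (Fin 3) ℝ := ∑ j, pderiv j (g j)
  have hm : ∀ i j, (g i * (X j - C (c j))).totalDegree ≤ k + 1 := fun i j =>
    (totalDegree_mul _ _).trans (add_le_add (hg i) (aux_deg_lin c j))
  refine ⟨w, dv, ?_, ?_, ?_⟩
  · intro i
    fin_cases i <;> exact (totalDegree_sub _ _).trans (max_le (hm _ _) (hm _ _))
  · exact totalDegree_finsetSum_le fun i _ => by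
      have := aux_deg_pderiv i (g i)
      have := hg i
      omega
  · intro i
    rw [show (2 : ℝ) • g i = g i + g i from two_smul _ _]
    fin_cases i <;>
    simp [w, dv, aux_curl, aux_E, Fin.sum_univ_three, pderiv_mul, pderiv_X] <;> ring

open MvPolynomial in
theorem aux_curl_lin (a b : ℝ) (u v : Fin 3 → MvPolynomial (Fin 3) ℝ) (i : Fin 3) :
    aux_curl (fun j => a • u j + b • v j) i = a • aux_curl u i + b • aux_curl v i := by
  fin_cases i <;> simp [aux_curl] <;> module

open MvPolynomial in
theorem aux_deg_lincomb (a b : ℝ) (m : ℕ) (p q : MvPolynomial (Fin 3) ℝ)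
    (hp : p.totalDegree ≤ m) (hq : q.totalDegree ≤ m) : (a • p + b • q).totalDegree ≤ m :=
  (totalDegree_add _ _).trans (max_le ((totalDegree_smul_le _ _).trans hp)
      ((totalDegree_smul_le _ _).trans hq))

open MvPolynomial in
theorem aux_decomp (c : Fin 3 → ℝ) (k : ℕ) (g : Fin 3 → MvPolynomial (Fin 3) ℝ)
    (hg : ∀ i, (g i).totalDegree ≤ k) :
    ∃ (v : Fin 3 → MvPolynomial (Fin 3) ℝ) (p : MvPolynomial (Fin 3) ℝ),
      (∀ i, (v i).totalDegree ≤ k + 1) ∧ p.totalDegree ≤ k ∧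
      ∀ i, g i = aux_curl v i + p * (X i - C (c i)) := by
  induction k generalizing g with
  | zero =>
    obtain ⟨w, dv, hw, hdv, hid⟩ := aux_step c 0 g hg
    refine ⟨fun j => (1/2 : ℝ) • w j + (0 : ℝ) • w j, (1/2 : ℝ) • dv + (0 : ℝ) • dv,
      fun j => aux_deg_lincomb _ _ _ _ _ (hw j) (hw j),
      aux_deg_lincomb _ _ _ _ _ hdv hdv, fun i => ?_⟩
    have h := hid i
    rw [aux_E_zero c _ (hg i), add_zero] at h
    rw [aux_curl_lin]
    have : g i = (1/2 : ℝ) • ((2 : ℝ) • g i) := by module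
    rw [this, h, zero_smul, zero_smul, add_zero, add_zero, smul_add, smul_mul_assoc]
  | succ k ih =>
    obtain ⟨w, dv, hw, hdv, hid⟩ := aux_step c (k+1) g hg
    obtain ⟨v, p, hv, hp, hid'⟩ := ih (fun i => ((k : ℝ) + 1) • g i - aux_E c (g i))
      (fun i => aux_drop c k _ (hg i))
    refine ⟨fun j => ((k : ℝ) + 3)⁻¹ • w j + ((k : ℝ) + 3)⁻¹ • v j,
      ((k : ℝ) + 3)⁻¹ • dv + ((k : ℝ) + 3)⁻¹ • p,
      fun j => aux_deg_lincomb _ _ _ _ _ (hw j) ((hv j).trans (by omega)),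
      aux_deg_lincomb _ _ _ _ _ hdv (hp.trans (by omega)), fun i => ?_⟩
    have h := hid i
    have h' := hid' i
    rw [aux_curl_lin, ← smul_add, ← smul_add, smul_mul_assoc, ← smul_add, add_mul,
      add_add_add_comm, ← h, ← h']
    have : (2 : ℝ) • g i + aux_E c (g i) + (((k : ℝ) + 1) • g i - aux_E c (g i)) =
      ((k : ℝ) + 3) • g i := by module
    rw [this, smul_smul, inv_mul_cancel₀ (by positivity), one_smul]

open MvPolynomial in
theorem aux_direct (c : Fin 3 → ℝ) (v : Fin 3 → MvPolynomial (Fin 3) ℝ)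
    (p : MvPolynomial (Fin 3) ℝ) (h : ∀ i, aux_curl v i + p * (X i - C (c i)) = 0) : p = 0 := by
  apply aux_inj c _ p le_rfl
  have h0 := congrArg (pderiv 0) (h 0)
  have h1 := congrArg (pderiv 1) (h 1)
  have h2 := congrArg (pderiv 2) (h 2)
  simp [aux_curl, pderiv_mul, pderiv_X] at h0 h1 h2
  rw [aux_comm 0 1] at h0
  rw [aux_comm 0 2] at h0
  rw [aux_comm 1 2] at h1
  have h3 : (3 : ℝ) • p = p + p + p := by module
  rw [h3]
  simp only [aux_E, Fin.sum_univ_three]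
  linear_combination h0 + h1 + h2

open MvPolynomial in
def aux_ev (P : Fin 3 → MvPolynomial (Fin 3) ℝ) : (Fin 3 → ℝ) → (Fin 3 → ℝ) :=
  fun x i => eval x (P i)

theorem aux_ev_inj (P Q : Fin 3 → MvPolynomial (Fin 3) ℝ) (h : aux_ev P = aux_ev Q) : P = Q := by
  funext i
  apply MvPolynomial.funext
  intro x
  exact congrFun (congrFun h x) i

open MvPolynomial in
theorem aux_mem_poly (m : ℕ) (f : (Fin 3 → ℝ) → ℝ) :
    f ∈ polySpaceZ 3 (m : ℤ) ↔
      ∃ p : MvPolynomial (Fin 3) ℝ, p.totalDegree ≤ m ∧ f = fun x => eval x p := by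
  rw [polySpaceZ, if_pos (by positivity), Int.toNat_natCast]
  constructor
  · rintro ⟨p, hp, h⟩
    exact ⟨p, hp, funext h⟩
  · rintro ⟨p, hp, h⟩
    exact ⟨p, hp, congrFun h⟩

theorem aux_mem_vec (m : ℕ) (f : (Fin 3 → ℝ) → (Fin 3 → ℝ)) :
    f ∈ vecPolySpaceZ 3 (m : ℤ) ↔
      ∃ P : Fin 3 → MvPolynomial (Fin 3) ℝ, (∀ i, (P i).totalDegree ≤ m) ∧ f = aux_ev P := by
  constructor
  · intro h
    choose P hP hf using fun i => (aux_mem_poly m _).1 (h i)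
    exact ⟨P, hP, by funext x i; exact congrFun (hf i) x⟩
  · rintro ⟨P, hP, rfl⟩ i
    exact (aux_mem_poly m _).2 ⟨P i, hP i, rfl⟩

theorem aux_curl_ev (P : Fin 3 → MvPolynomial (Fin 3) ℝ) :
    curl (aux_ev P) = aux_ev (aux_curl P) := by
  funext x i
  simp only [curl, aux_ev, aux_fderiv]
  fin_cases i <;> simp [aux_curl]

open MvPolynomial in
theorem aux_deg_curl (m : ℕ) (v : Fin 3 → MvPolynomial (Fin 3) ℝ)
    (hv : ∀ i, (v i).totalDegree ≤ m + 1) (i : Fin 3) : (aux_curl v i).totalDegree ≤ m := by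
  have h : ∀ i j, (pderiv i (v j)).totalDegree ≤ m := fun i j => by
    have := aux_deg_pderiv i (v j)
    have := hv j
    omega
  fin_cases i <;> exact (totalDegree_sub _ _).trans (max_le (h _ _) (h _ _))

open MvPolynomial in
theorem aux_lin_ne (c : Fin 3 → ℝ) (i : Fin 3) :
    (X i - C (c i) : MvPolynomial (Fin 3) ℝ) ≠ 0 := by
  intro h
  have := congrArg (eval (fun j => c j + 1)) h
  simp at this

open MvPolynomial in
theorem aux_deg_lin_eq (c : Fin 3 → ℝ) (i : Fin 3) :
    (X i - C (c i) : MvPolynomial (Fin 3) ℝ).totalDegree = 1 := by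
  refine le_antisymm (aux_deg_lin c i) ?_
  have h := totalDegree_add (X i - C (c i) : MvPolynomial (Fin 3) ℝ) (C (c i))
  simpa using h

open MvPolynomial in
theorem aux_deg_mul_lin (c : Fin 3 → ℝ) (i : Fin 3) (p : MvPolynomial (Fin 3) ℝ) (hp : p ≠ 0) :
    (p * (X i - C (c i))).totalDegree = p.totalDegree + 1 := by
  rw [totalDegree_mul_of_isDomain hp (aux_lin_ne c i), aux_deg_lin_eq]

/-- The Raviart–Thomas space `ℛ𝒯ⁿ_c = 𝒞^{n-1} ⊕ 𝒞ⁿ_c` in `ℝ³`: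
(i) the sum is direct, (ii) `ℛ𝒯ⁿ_c = (𝒫^{n-1})³ + 𝒞ⁿ_c`, and
(iii) `(𝒫^{n-1})³ ⊊ ℛ𝒯ⁿ_c ⊊ (𝒫ⁿ)³`. -/
theorem statement4 (n : ℕ) (hn : 1 ≤ n) (c : Fin 3 → ℝ) :
    let C : Set ((Fin 3 → ℝ) → (Fin 3 → ℝ)) :=
      {f | ∃ v ∈ vecPolySpaceZ 3 (n : ℤ), f = curl v}
    let Cc : Set ((Fin 3 → ℝ) → (Fin 3 → ℝ)) :=
      {f | ∃ p ∈ polySpaceZ 3 ((n : ℤ) - 1), f = fun x => p x • (x - c)}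
    let RT : Set ((Fin 3 → ℝ) → (Fin 3 → ℝ)) :=
      {f | ∃ g ∈ C, ∃ h ∈ Cc, f = g + h}
    (∀ g ∈ C, ∀ h ∈ Cc, ∀ g' ∈ C, ∀ h' ∈ Cc, g + h = g' + h' → g = g' ∧ h = h') ∧
    RT = {f | ∃ g ∈ vecPolySpaceZ 3 ((n : ℤ) - 1), ∃ h ∈ Cc, f = g + h} ∧
    (vecPolySpaceZ 3 ((n : ℤ) - 1) : Set _) ⊂ RT ∧
    RT ⊂ (vecPolySpaceZ 3 (n : ℤ) : Set _) := by
  intro C Cc RT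
  obtain ⟨m, rfl⟩ : ∃ m, n = m + 1 := ⟨n - 1, by omega⟩
  have hm : ((m + 1 : ℕ) : ℤ) - 1 = (m : ℤ) := by push_cast; ring
  have hC : ∀ f, f ∈ C ↔ ∃ v : Fin 3 → MvPolynomial (Fin 3) ℝ,
      (∀ i, (v i).totalDegree ≤ m + 1) ∧ f = aux_ev (aux_curl v) := by
    intro f
    constructor
    · rintro ⟨v, hv, rfl⟩
      obtain ⟨P, hP, rfl⟩ := (aux_mem_vec _ _).1 hv
      exact ⟨P, hP, aux_curl_ev P⟩
    · rintro ⟨v, hv, rfl⟩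
      exact ⟨aux_ev v, (aux_mem_vec _ _).2 ⟨v, hv, rfl⟩, (aux_curl_ev v).symm⟩
  have hCc : ∀ f, f ∈ Cc ↔ ∃ p : MvPolynomial (Fin 3) ℝ, p.totalDegree ≤ m ∧
      f = aux_ev (fun i => p * (MvPolynomial.X i - MvPolynomial.C (c i))) := by
    intro f
    constructor
    · rintro ⟨p, hp, rfl⟩
      rw [hm] at hp
      obtain ⟨P, hP, rfl⟩ := (aux_mem_poly _ _).1 hp
      exact ⟨P, hP, by funext x i; simp [aux_ev]⟩
    · rintro ⟨p, hp, rfl⟩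
      refine ⟨fun x => MvPolynomial.eval x p, ?_, by funext x i; simp [aux_ev]⟩
      rw [hm]
      exact (aux_mem_poly _ _).2 ⟨p, hp, rfl⟩
  have hadd : ∀ P Q, aux_ev P + aux_ev Q = aux_ev (P + Q) := by
    intro P Q; funext x i; simp [aux_ev]
  have hCvec : ∀ f ∈ C, f ∈ vecPolySpaceZ 3 (((m + 1 : ℕ) : ℤ) - 1) := by
    intro f hf
    obtain ⟨v, hv, rfl⟩ := (hC f).1 hf
    rw [hm]
    exact (aux_mem_vec _ _).2 ⟨_, aux_deg_curl m v hv, rfl⟩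
  have hvec : ∀ f ∈ vecPolySpaceZ 3 (((m + 1 : ℕ) : ℤ) - 1), f ∈ RT := by
    intro f hf
    rw [hm] at hf
    obtain ⟨g, hg, rfl⟩ := (aux_mem_vec _ _).1 hf
    obtain ⟨v, p, hv, hp, h⟩ := aux_decomp c m g hg
    refine ⟨_, (hC _).2 ⟨v, hv, rfl⟩, _, (hCc _).2 ⟨p, hp, rfl⟩, ?_⟩
    rw [hadd]
    congr 1
    funext i
    exact h i
  have hCcadd : ∀ f ∈ Cc, ∀ g ∈ Cc, f + g ∈ Cc := by
    rintro f ⟨p, hp, rfl⟩ g ⟨q, hq, rfl⟩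
    exact ⟨p + q, Submodule.add_mem _ hp hq, by funext x i; simp [add_mul]⟩
  have hii : RT = {f | ∃ g ∈ vecPolySpaceZ 3 (((m + 1 : ℕ) : ℤ) - 1), ∃ h ∈ Cc, f = g + h} := by
    ext f
    constructor
    · rintro ⟨g, hg, h, hh, rfl⟩
      exact ⟨g, hCvec g hg, h, hh, rfl⟩
    · rintro ⟨g, hg, h, hh, rfl⟩
      obtain ⟨g', hg', h', hh', rfl⟩ := hvec g hg
      exact ⟨g', hg', h' + h, hCcadd _ hh' _ hh, add_assoc _ _ _⟩
  refine ⟨?_, hii, ⟨hvec, ?_⟩, ⟨?_, ?_⟩⟩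
  · intro g hg h hh g' hg' h' hh' e
    suffices h = h' by
      subst this
      exact ⟨add_right_cancel e, rfl⟩
    obtain ⟨v, hv, rfl⟩ := (hC _).1 hg
    obtain ⟨v', hv', rfl⟩ := (hC _).1 hg'
    obtain ⟨p, hp, rfl⟩ := (hCc _).1 hh
    obtain ⟨p', hp', rfl⟩ := (hCc _).1 hh'
    rw [hadd, hadd] at e
    have e := aux_ev_inj _ _ e
    have : p - p' = 0 := by
      apply aux_direct c (fun j => (1 : ℝ) • v j + (-1 : ℝ) • v' j)
      intro i
      have := congrFun e i
      simp only [Pi.add_apply] at this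
      rw [aux_curl_lin]
      simp only [one_smul, neg_smul]
      linear_combination this
    rw [sub_eq_zero.1 this]
  · intro hsub
    have h0 : aux_ev (fun i => (MvPolynomial.X 0) ^ m *
        (MvPolynomial.X i - MvPolynomial.C (c i))) ∈ RT := by
      rw [hii]
      refine ⟨0, Submodule.zero_mem _, _, (hCc _).2 ⟨(MvPolynomial.X 0) ^ m, ?_, rfl⟩, ?_⟩
      · simp
      · simp
    have h1 := hsub h0
    rw [hm] at h1
    obtain ⟨P, hP, e⟩ := (aux_mem_vec _ _).1 h1
    have e := congrFun (aux_ev_inj _ _ e) 0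
    have h2 := hP 0
    rw [← e, aux_deg_mul_lin c 0 _ (pow_ne_zero _ (MvPolynomial.X_ne_zero _)),
      MvPolynomial.totalDegree_X_pow] at h2
    omega
  · intro f hf
    rw [hii] at hf
    obtain ⟨g, hg, h, hh, rfl⟩ := hf
    rw [hm] at hg
    obtain ⟨P, hP, rfl⟩ := (aux_mem_vec _ _).1 hg
    obtain ⟨p, hp, rfl⟩ := (hCc _).1 hh
    rw [hadd]
    refine (aux_mem_vec _ _).2 ⟨_, fun i => ?_, rfl⟩
    refine (MvPolynomial.totalDegree_add _ _).trans (max_le ((hP i).trans (by omega)) ?_)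
    exact (MvPolynomial.totalDegree_mul _ _).trans (add_le_add hp (aux_deg_lin c i))
  · intro hsub
    have h0 : aux_ev ![0, (MvPolynomial.X 0) ^ (m + 1), 0] ∈
        vecPolySpaceZ 3 ((m + 1 : ℕ) : ℤ) := by
      refine (aux_mem_vec _ _).2 ⟨_, fun i => ?_, rfl⟩
      fin_cases i <;> simp
    have h1 := hsub h0
    rw [hii] at h1
    obtain ⟨g, hg, h, hh, e⟩ := h1
    rw [hm] at hg
    obtain ⟨P, hP, rfl⟩ := (aux_mem_vec _ _).1 hg
    obtain ⟨p, hp, rfl⟩ := (hCc _).1 hh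
    rw [hadd] at e
    have e := aux_ev_inj _ _ e
    have e0 := congrFun e 0
    have e1 := congrFun e 1
    simp only [Pi.add_apply, Matrix.cons_val_zero, Matrix.cons_val_one] at e0 e1
    have hdeg : (p * (MvPolynomial.X 1 - MvPolynomial.C (c 1))).totalDegree ≤ m := by
      by_cases hp0 : p = 0
      · simp [hp0]
      · have h2 := aux_deg_mul_lin c 0 p hp0
        rw [← neg_eq_of_add_eq_zero_right e0.symm, MvPolynomial.totalDegree_neg] at h2
        rw [aux_deg_mul_lin c 1 p hp0, ← h2]
        exact hP 0
    have h3 := (MvPolynomial.totalDegree_add (P 1) _).trans (max_le (hP 1) hdeg)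
    rw [← e1, MvPolynomial.totalDegree_X_pow] at h3
    omega

end
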